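/- Let C, C' ⊆ F[z]^n be convolutional codes of degree δ each having at most one positive Forney index. Then the following are equivalent: (i) C and C' are strongly isometric and there exist basic reduced encoders G of C and G' of C' and an invertible matrix T ∈ GL_δ(F) such that Λ(G)_{X,Y} = Λ(G')_{XT,YT} for all X, Y ∈ F^δ (i.e. for all X, Y ∈ F^δ and w ∈ ℕ₀, the number of u ∈ F^k with Y = XA + uB and wt(XC + uD) = w equals the number of u ∈ F^k with YT = (XT)A' + uB' and wt((XT)C' + uD') = w, where (A,B,C,D) and (A',B',C',D') are the CCFs of G and G'); (ii) C and C' are monomially equivalent. -/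

import Mathlib

open Matrix Polynomial

variable {F : Type*} [Field F]

/-- The weight of a polynomial row vector: the total number of nonzero
coefficients occurring in its entries. -/
def wtP {n : ℕ} (v : Fin n → Polynomial F) : ℕ := ∑ i, (v i).support.card

/-- The degree of a polynomial row vector: the maximal degree of its entries. -/
def degP {n : ℕ} (v : Fin n → Polynomial F) : ℕ := Finset.univ.sup fun i => (v i).natDegree

/-- The delay of a polynomial row vector: the least `t` such that the `t`-th
coefficient vector is nonzero. -/
noncomputable def delP {n : ℕ} (v : Fin n → Polynomial F) : ℕ :=
  sInf {t : ℕ | ∃ i, (v i).coeff t ≠ 0}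

/-- A polynomial matrix is basic if its evaluation at every point of the algebraic
closure has full row rank. -/
def IsBasic {k n : ℕ} (G : Matrix (Fin k) (Fin n) (Polynomial F)) : Prop :=
  ∀ lam : AlgebraicClosure F, (G.map fun p => (Polynomial.aeval lam) p).rank = k

/-- The set of codewords generated by the encoder `G`. -/
def codeOf {k n : ℕ} (G : Matrix (Fin k) (Fin n) (Polynomial F)) :
    Set (Fin n → Polynomial F) :=
  Set.range fun u : Fin k → Polynomial F => u ᵥ* G

/-- A convolutional code of length `n`: a submodule of `F[z]^n` generated by some
basic matrix. -/
def IsConvCode {n : ℕ} (C : Submodule (Polynomial F) (Fin n → Polynomial F)) : Prop :=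
  ∃ (k : ℕ) (G : Matrix (Fin k) (Fin n) (Polynomial F)),
    IsBasic G ∧ (C : Set (Fin n → Polynomial F)) = codeOf G

/-- A monomial matrix over `F`: permutation times invertible diagonal. -/
def IsMonomialMatrix {n : ℕ} (M : Matrix (Fin n) (Fin n) F) : Prop :=
  ∃ (σ : Equiv.Perm (Fin n)) (d : Fin n → Fˣ),
    ∀ i j, M i j = if σ i = j then (d j : F) else 0

/-- The `i`-th row degree of a polynomial matrix. -/
def rowDeg {k n : ℕ} (G : Matrix (Fin k) (Fin n) (Polynomial F)) (i : Fin k) : ℕ :=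
  Finset.univ.sup fun j => (G i j).natDegree

/-- The (internal) degree of a polynomial matrix: the maximal degree of its `k × k` minors. -/
noncomputable def degMat {k n : ℕ} (G : Matrix (Fin k) (Fin n) (Polynomial F)) : ℕ :=
  Finset.univ.sup fun f : Fin k ↪ Fin n => (Matrix.det fun i i' => G i (f i')).natDegree

/-- A polynomial matrix is reduced if the sum of its row degrees equals its degree. -/
noncomputable def IsRowReduced {k n : ℕ} (G : Matrix (Fin k) (Fin n) (Polynomial F)) : Prop :=
  (∑ i, rowDeg G i) = degMat G

/-- Index set for the state space of the controller canonical form with row degrees `ν`. -/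
abbrev StateIdx {k : ℕ} (ν : Fin k → ℕ) := (i : Fin k) × Fin (ν i)

/-- The matrix `A` of the controller canonical form. -/
def ccfA {k : ℕ} (ν : Fin k → ℕ) : Matrix (StateIdx ν) (StateIdx ν) F :=
  fun p q => if p.1 = q.1 ∧ (q.2 : ℕ) = (p.2 : ℕ) + 1 then 1 else 0

/-- The matrix `B` of the controller canonical form. -/
def ccfB {k : ℕ} (ν : Fin k → ℕ) : Matrix (Fin k) (StateIdx ν) F :=
  fun i q => if i = q.1 ∧ (q.2 : ℕ) = 0 then 1 else 0

/-- The matrix `C` of the controller canonical form of `G`. -/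
def ccfC {k n : ℕ} (G : Matrix (Fin k) (Fin n) (Polynomial F)) :
    Matrix (StateIdx (rowDeg G)) (Fin n) F :=
  fun p j => (G p.1 j).coeff ((p.2 : ℕ) + 1)

/-- The matrix `D` of the controller canonical form of `G`. -/
def ccfD {k n : ℕ} (G : Matrix (Fin k) (Fin n) (Polynomial F)) :
    Matrix (Fin k) (Fin n) F :=
  fun i j => (G i j).coeff 0

/-- The entry of the weight adjacency matrix of `G` at the pair of states `(X, Y)`:
the coefficient of `W^w` is the number of inputs `u` realizing the state transition
`X → Y` whose corresponding output has Hamming weight `w`. -/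
noncomputable def WAMe {k n : ℕ} [DecidableEq F] (G : Matrix (Fin k) (Fin n) (Polynomial F))
    (X Y : StateIdx (rowDeg G) → F) (w : ℕ) : ℕ :=
  Set.ncard {u : Fin k → F |
    X ᵥ* ccfA (rowDeg G) + u ᵥ* ccfB (rowDeg G) = Y ∧
    hammingNorm (X ᵥ* ccfC G + u ᵥ* ccfD G) = w}

/-- The canonical enumeration of the state indices. -/
def encIdx {k : ℕ} (ν : Fin k → ℕ) (p : StateIdx ν) : ℕ :=
  (∑ i' ∈ Finset.univ.filter (fun i' => i' < p.1), ν i') + (p.2 : ℕ)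

theorem encIdx_lt {k : ℕ} (ν : Fin k → ℕ) (p : StateIdx ν) : encIdx ν p < ∑ i, ν i := by
  have h1 : (p.2 : ℕ) < ν p.1 := p.2.isLt
  have h2 : ν p.1 ≤ ∑ i' ∈ Finset.univ.filter (fun i' => ¬ i' < p.1), ν i' :=
    Finset.single_le_sum (fun i _ => Nat.zero_le _) (by simp)
  have h3 := Finset.sum_filter_add_sum_filter_not Finset.univ (fun i' => i' < p.1) ν
  unfold encIdx
  omega

/-- The canonical identification of the state space with `Fin δ`. -/
def stateEnc {k : ℕ} (ν : Fin k → ℕ) {δ : ℕ} (h : (∑ i, ν i) = δ) (p : StateIdx ν) : Fin δ :=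
  ⟨encIdx ν p, h ▸ encIdx_lt ν p⟩

/-- The entry of the weight adjacency matrix of `G` at states `X, Y ∈ F^δ`, using the
canonical identification of the state space of the controller canonical form with `F^δ`. -/
noncomputable def WAMfin {k n δ : ℕ} [DecidableEq F] (G : Matrix (Fin k) (Fin n) (Polynomial F))
    (h : (∑ i, rowDeg G i) = δ) (X Y : Fin δ → F) (w : ℕ) : ℕ :=
  WAMe G (fun p => X (stateEnc (rowDeg G) h p)) (fun p => Y (stateEnc (rowDeg G) h p)) w


/-! ### The MacWilliams extension theorem for block codes -/

open Classical in
theorem card_fiber_eq_of_card_Ici_eq {P ι : Type*} [PartialOrder P] [Finite P] [Fintype ι]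
    (a b : ι → P)
    (h : ∀ H, (Finset.univ.filter fun j => H ≤ a j).card =
      (Finset.univ.filter fun j => H ≤ b j).card) (H : P) :
    (Finset.univ.filter fun j => a j = H).card = (Finset.univ.filter fun j => b j = H).card := by
  have := Fintype.ofFinite P
  induction H using WellFoundedGT.induction with
  | ind H ih =>
    have key : ∀ c : ι → P, (Finset.univ.filter fun j => H ≤ c j).card =
        (Finset.univ.filter fun j => c j = H).card +
          ∑ K ∈ Finset.univ.filter (H < ·), (Finset.univ.filter fun j => c j = K).card := by
      intro c
      have h1 : (Finset.univ.filter fun j => H ≤ c j) =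
          (Finset.univ.filter fun j => c j = H) ∪ (Finset.univ.filter fun j => H < c j) := by
        ext j
        simp only [Finset.mem_filter, Finset.mem_union, Finset.mem_univ, true_and]
        rw [le_iff_eq_or_lt, eq_comm]
      rw [h1, Finset.card_union_of_disjoint]
      · congr 1
        rw [Finset.card_eq_sum_card_fiberwise (f := c) (t := Finset.univ.filter (H < ·))]
        · refine Finset.sum_congr rfl fun K hK => congrArg Finset.card ?_
          ext j
          simp only [Finset.mem_filter, Finset.mem_univ, true_and] at hK ⊢
          exact ⟨fun h => h.2, fun h => ⟨h ▸ hK, h⟩⟩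
        · intro j hj
          simpa using hj
      · rw [Finset.disjoint_filter]
        rintro j - h1 h2
        exact h2.ne h1.symm
    have e := h H
    rw [key a, key b, Finset.sum_congr rfl fun K hK => ih K (by simpa using hK)] at e
    exact Nat.add_right_cancel e

open Classical in
theorem card_mul_card_zeros {W : Type*} [AddCommGroup W] [Module F W] [Finite W] [Finite F]
    (f : W →ₗ[F] F) :
    Nat.card F * Nat.card {x : W // f x = 0} =
      if f = 0 then Nat.card F * Nat.card W else Nat.card W := by
  split_ifs with h
  · subst h
    congr 1
    exact Nat.card_congr (Equiv.subtypeUnivEquiv fun x => by simp)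
  · have h1 := Submodule.card_eq_card_quotient_mul_card (LinearMap.ker f)
    have h2 : Nat.card (W ⧸ LinearMap.ker f) = Nat.card F :=
      Nat.card_congr (f.quotKerEquivOfSurjective (LinearMap.surjective h)).toEquiv
    rw [h2] at h1
    rw [h1, mul_comm]
    rfl

open Classical in
theorem card_le_ker_eq {V : Type*} [AddCommGroup V] [Module F V] [Finite V] [Finite F]
    {ι : Type*} [Fintype ι] (f g : ι → V →ₗ[F] F)
    (h : ∀ x, (Finset.univ.filter fun j => f j x = 0).card =
      (Finset.univ.filter fun j => g j x = 0).card) (H : Submodule F V) :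
    (Finset.univ.filter fun j => H ≤ LinearMap.ker (f j)).card =
      (Finset.univ.filter fun j => H ≤ LinearMap.ker (g j)).card := by
  have := Fintype.ofFinite H
  have key : ∀ f : ι → V →ₗ[F] F,
      Nat.card F * ∑ x : H, (Finset.univ.filter fun j => f j x = 0).card =
        Fintype.card ι * Nat.card H + (Nat.card F - 1) * Nat.card H *
          (Finset.univ.filter fun j => H ≤ LinearMap.ker (f j)).card := by
    intro f
    have hF : 1 ≤ Nat.card F := Nat.card_pos
    simp only [Finset.card_filter (fun j => f j _ = 0)]
    rw [Finset.sum_comm, Finset.mul_sum]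
    have h1 : ∀ j, Nat.card F * ∑ x : H, (if f j x = 0 then 1 else 0) =
        Nat.card H + (Nat.card F - 1) * Nat.card H *
          (if H ≤ LinearMap.ker (f j) then 1 else 0) := by
      intro j
      have h2 := card_mul_card_zeros ((f j).comp H.subtype)
      have h3 : (f j).comp H.subtype = 0 ↔ H ≤ LinearMap.ker (f j) := by
        rw [LinearMap.ext_iff]
        exact ⟨fun h x hx => h ⟨x, hx⟩, fun h x => h x.2⟩
      rw [← Finset.card_filter, ← Fintype.card_subtype, ← Nat.card_eq_fintype_card]
      refine h2.trans ?_
      simp only [h3]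
      split_ifs
      · obtain ⟨m, hm⟩ := Nat.exists_eq_add_of_le hF
        rw [hm, Nat.add_sub_cancel_left]
        ring
      · simp
    rw [Finset.sum_congr rfl fun j _ => h1 j, Finset.sum_add_distrib, ← Finset.mul_sum,
      ← Finset.card_filter]
    simp
  have e := key f
  rw [Finset.sum_congr rfl fun (x : H) _ => h x, key g] at e
  have hpos : 0 < (Nat.card F - 1) * Nat.card H :=
    Nat.mul_pos (Nat.sub_pos_of_lt Finite.one_lt_card) Nat.card_pos
  exact (Nat.eq_of_mul_eq_mul_left hpos (Nat.add_left_cancel e)).symm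

theorem exists_unit_smul_eq_of_ker_eq {V : Type*} [AddCommGroup V] [Module F V]
    (f g : V →ₗ[F] F) (h : LinearMap.ker f = LinearMap.ker g) :
    ∃ d : Fˣ, ∀ x, g x = d * f x := by
  by_cases hf : f = 0
  · subst hf
    refine ⟨1, fun x => ?_⟩
    have : x ∈ LinearMap.ker g := by rw [← h]; simp
    simpa using this
  · obtain ⟨x₀, hx₀⟩ := LinearMap.surjective hf 1
    have hg : g x₀ ≠ 0 := fun h0 => by
      have : x₀ ∈ LinearMap.ker f := by rw [h]; exact h0
      rw [LinearMap.mem_ker, hx₀] at this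
      exact one_ne_zero this
    refine ⟨Units.mk0 _ hg, fun x => ?_⟩
    have : x - f x • x₀ ∈ LinearMap.ker g := by
      rw [← h, LinearMap.mem_ker]
      simp [hx₀]
    rw [LinearMap.mem_ker, map_sub, map_smul, sub_eq_zero] at this
    rw [this, Units.val_mk0, smul_eq_mul, mul_comm]

/-- A weight-preserving correspondence of block codes is given by a monomial matrix. -/
theorem exists_monomial_of_hammingNorm_eq [DecidableEq F] {V : Type*} [AddCommGroup V] [Module F V]
    [Finite V] [Finite F] {n : ℕ} (f g : V →ₗ[F] (Fin n → F))
    (h : ∀ x, hammingNorm (f x) = hammingNorm (g x)) :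
    ∃ M : Matrix (Fin n) (Fin n) F, IsMonomialMatrix M ∧ ∀ x, g x = f x ᵥ* M := by
  classical
  let a : Fin n → V →ₗ[F] F := fun j => LinearMap.proj j ∘ₗ f
  let b : Fin n → V →ₗ[F] F := fun j => LinearMap.proj j ∘ₗ g
  have hz : ∀ x, (Finset.univ.filter fun j => a j x = 0).card =
      (Finset.univ.filter fun j => b j x = 0).card := by
    intro x
    have h1 := Finset.card_filter_add_card_filter_not (s := Finset.univ) fun j => f x j = 0
    have h2 := Finset.card_filter_add_card_filter_not (s := Finset.univ) fun j => g x j = 0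
    have h3 := h x
    unfold hammingNorm at h3
    change (Finset.univ.filter fun j => f x j = 0).card =
      (Finset.univ.filter fun j => g x j = 0).card
    simp only [ne_eq] at h3
    omega
  have hfib := card_fiber_eq_of_card_Ici_eq (fun j => LinearMap.ker (a j))
    (fun j => LinearMap.ker (b j)) (fun H => by
      convert card_le_ker_eq a b (fun x => by convert hz x) H)
  let σ : Equiv.Perm (Fin n) := Equiv.ofFiberEquiv (f := fun j => LinearMap.ker (a j))
    (g := fun j => LinearMap.ker (b j)) fun H => Fintype.equivOfCardEq (by
      rw [Fintype.card_subtype, Fintype.card_subtype]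
      convert hfib H)
  have hσ : ∀ i, LinearMap.ker (a i) = LinearMap.ker (b (σ i)) := fun i =>
    (Equiv.ofFiberEquiv_map (f := fun j => LinearMap.ker (a j))
      (g := fun j => LinearMap.ker (b j)) _ i).symm
  choose d hd using fun i => exists_unit_smul_eq_of_ker_eq _ _ (hσ i)
  refine ⟨fun i j => if σ i = j then (d (σ.symm j) : F) else 0, ⟨σ, fun j => d (σ.symm j),
    fun i j => rfl⟩, fun x => funext fun j => ?_⟩
  change _ = ∑ i, f x i * (if σ i = j then (d (σ.symm j) : F) else 0)
  rw [Finset.sum_eq_single (σ.symm j)]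
  · have := hd (σ.symm j) x
    rw [Equiv.apply_symm_apply] at this
    change g x j = d (σ.symm j) * f x (σ.symm j) at this
    simpa [mul_comm] using this
  · intro i _ hi
    rw [if_neg (fun h => hi (by rw [← h, Equiv.symm_apply_apply])), mul_zero]
  · simp

/-! ### Coefficient vectors and weights -/

/-- The coefficient vector of `z ^ t` in a polynomial row vector. -/
def coeffVec {n : ℕ} (v : Fin n → F[X]) (t : ℕ) : Fin n → F := fun j => (v j).coeff t

theorem coeffVec_eq_zero_of_degP_lt {n : ℕ} {v : Fin n → F[X]} {t : ℕ} (h : degP v < t) :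
    coeffVec v t = 0 := funext fun j => coeff_eq_zero_of_natDegree_lt
  (lt_of_le_of_lt (Finset.le_sup (f := fun i => (v i).natDegree) (Finset.mem_univ j)) h)

theorem degP_le_iff {n : ℕ} {v : Fin n → F[X]} {d : ℕ} :
    degP v ≤ d ↔ ∀ t, d < t → coeffVec v t = 0 := by
  refine ⟨fun h t ht => coeffVec_eq_zero_of_degP_lt (lt_of_le_of_lt h ht), fun h => ?_⟩
  refine Finset.sup_le fun j _ => natDegree_le_iff_coeff_eq_zero.2 fun t ht => ?_
  exact congrFun (h t ht) j

theorem wtP_eq_sum_hammingNorm [DecidableEq F] {n N : ℕ} {v : Fin n → F[X]} (h : degP v < N) :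
    wtP v = ∑ t ∈ Finset.range N, hammingNorm (coeffVec v t) := by
  have h1 : ∀ j, (v j).support.card =
      ∑ t ∈ Finset.range N, if (v j).coeff t ≠ 0 then 1 else 0 := by
    intro j
    rw [← Finset.card_filter]
    congr 1
    ext t
    simp only [mem_support_iff, Finset.mem_filter, Finset.mem_range]
    refine ⟨fun ht => ⟨lt_of_not_ge fun hN => ht ?_, ht⟩, fun h => h.2⟩
    exact congrFun (coeffVec_eq_zero_of_degP_lt (lt_of_lt_of_le h hN)) j
  unfold wtP
  rw [Finset.sum_congr rfl fun j _ => h1 j, Finset.sum_comm]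
  refine Finset.sum_congr rfl fun t _ => ?_
  rw [← Finset.card_filter]
  rfl

theorem wtP_eq_hammingNorm_of_degP_eq_zero [DecidableEq F] {n : ℕ} {v : Fin n → F[X]}
    (h : degP v = 0) : wtP v = hammingNorm (coeffVec v 0) := by
  rw [wtP_eq_sum_hammingNorm (N := 1) (by omega), Finset.sum_range_one]

theorem coeffVec_vecMul {k n : ℕ} (u : Fin k → F[X]) (G : Matrix (Fin k) (Fin n) F[X]) (t : ℕ)
    (j : Fin n) : coeffVec (u ᵥ* G) t j = ∑ i, (u i * G i j).coeff t := by
  simp [coeffVec, Matrix.vecMul, dotProduct]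

/-! ### Reduced encoders have the predictable degree property -/

/-- The matrix of leading row coefficients. -/
def leadMat {k n : ℕ} (G : Matrix (Fin k) (Fin n) F[X]) : Matrix (Fin k) (Fin n) F :=
  fun i j => (G i j).coeff (rowDeg G i)

theorem natDegree_le_rowDeg {k n : ℕ} (G : Matrix (Fin k) (Fin n) F[X]) (i : Fin k) (j : Fin n) :
    (G i j).natDegree ≤ rowDeg G i :=
  Finset.le_sup (f := fun j => (G i j).natDegree) (Finset.mem_univ j)

theorem coeff_prod_sum_of_natDegree_le {ι : Type*} (s : Finset ι) (f : ι → F[X]) (d : ι → ℕ)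
    (h : ∀ i ∈ s, (f i).natDegree ≤ d i) :
    (∏ i ∈ s, f i).coeff (∑ i ∈ s, d i) = ∏ i ∈ s, (f i).coeff (d i) := by
  classical
  induction s using Finset.induction_on with
  | empty => simp
  | insert a s ha ih =>
    have hs : ∀ i ∈ s, (f i).natDegree ≤ d i := fun i hi => h i (Finset.mem_insert_of_mem hi)
    rw [Finset.prod_insert ha, Finset.sum_insert ha, Finset.prod_insert ha,
      coeff_mul_add_eq_of_natDegree_le (h a (Finset.mem_insert_self _ _))
        ((natDegree_prod_le _ _).trans (Finset.sum_le_sum hs)), ih hs]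

theorem coeff_det_sum {k : ℕ} (A : Matrix (Fin k) (Fin k) F[X]) (d : Fin k → ℕ)
    (h : ∀ i j, (A i j).natDegree ≤ d i) :
    A.det.coeff (∑ i, d i) = (Matrix.of fun i j => (A i j).coeff (d i)).det := by
  rw [← Matrix.det_transpose A, ← Matrix.det_transpose (Matrix.of _), Matrix.det_apply,
    Matrix.det_apply, finsetSum_coeff]
  refine Finset.sum_congr rfl fun σ _ => ?_
  rw [coeff_smul]
  congr 1
  simp only [Matrix.transpose_apply, Matrix.of_apply]
  exact coeff_prod_sum_of_natDegree_le _ _ _ fun i _ => h _ _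

theorem eq_zero_of_vecMul_leadMat {k n : ℕ} {G : Matrix (Fin k) (Fin n) F[X]} (hb : IsBasic G)
    (hr : IsRowReduced G) {c : Fin k → F} (hc : c ᵥ* leadMat G = 0) : c = 0 := by
  rcases Nat.eq_zero_or_pos (degMat G) with h0 | hpos
  · have hν : ∀ i, rowDeg G i = 0 := by
      rw [← hr] at h0
      simpa using h0
    have hli : LinearIndependent (AlgebraicClosure F)
        (G.map fun p => aeval (0 : AlgebraicClosure F) p).row := by
      rw [linearIndependent_iff_card_eq_finrank_span, Set.finrank,
        ← Matrix.rank_eq_finrank_span_row, hb 0, Fintype.card_fin]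
    have := Fintype.linearIndependent_iff.1 hli (fun i => algebraMap F _ (c i)) (by
      ext j
      have h2 := congrArg (algebraMap F (AlgebraicClosure F)) (congrFun hc j)
      simp only [Matrix.vecMul, dotProduct, map_sum, map_mul, Pi.zero_apply, map_zero] at h2
      rw [Finset.sum_apply, Pi.zero_apply]
      refine Eq.trans ?_ h2
      refine Finset.sum_congr rfl fun i _ => ?_
      simp [leadMat, hν, Matrix.row, coeff_zero_eq_aeval_zero'])
    ext i
    simpa using this i
  · have hne : (Finset.univ : Finset (Fin k ↪ Fin n)).Nonempty := by
      rw [Finset.nonempty_iff_ne_empty]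
      intro he
      rw [degMat, he] at hpos
      simp at hpos
    obtain ⟨f, -, hf⟩ := Finset.exists_mem_eq_sup _ hne fun f : Fin k ↪ Fin n =>
      (Matrix.det fun i i' => G i (f i')).natDegree
    change degMat G = _ at hf
    refine Matrix.eq_zero_of_vecMul_eq_zero (M := Matrix.of fun i i' => leadMat G i (f i')) ?_ ?_
    · have h1 := coeff_det_sum (fun i i' => G i (f i')) (rowDeg G)
        fun i j => natDegree_le_rowDeg G _ _
      change _ = (Matrix.of fun i i' => leadMat G i (f i')).det at h1
      rw [← h1, hr, hf, coeff_natDegree]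
      intro h0
      rw [leadingCoeff_eq_zero] at h0
      rw [hf, h0] at hpos
      simp at hpos
    · ext j
      exact congrFun hc (f j)

/-- The predictable degree property. -/
def PredictableDegree {k n : ℕ} (G : Matrix (Fin k) (Fin n) F[X]) : Prop :=
  ∀ (u : Fin k → F[X]) (i : Fin k), u i ≠ 0 → (u i).natDegree + rowDeg G i ≤ degP (u ᵥ* G)

theorem predictableDegree_of_isRowReduced {k n : ℕ} {G : Matrix (Fin k) (Fin n) F[X]}
    (hb : IsBasic G) (hr : IsRowReduced G) : PredictableDegree G := by
  classical
  intro u i₀ hi₀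
  let s := Finset.univ.filter fun i => u i ≠ 0
  obtain ⟨m, hm, hmax⟩ := s.exists_max_image (fun i => (u i).natDegree + rowDeg G i)
    ⟨i₀, by simpa [s] using hi₀⟩
  set d := (u m).natDegree + rowDeg G m with hd
  let c : Fin k → F := fun i => if rowDeg G i ≤ d then (u i).coeff (d - rowDeg G i) else 0
  have hco : coeffVec (u ᵥ* G) d = c ᵥ* leadMat G := by
    ext j
    rw [coeffVec_vecMul, Matrix.vecMul, dotProduct]
    refine Finset.sum_congr rfl fun i _ => ?_
    by_cases hu : u i = 0
    · simp [hu, c]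
    · have h1 : (u i).natDegree + rowDeg G i ≤ d := hmax i (by simpa [s] using hu)
      have h2 : rowDeg G i ≤ d := by omega
      simp only [c, if_pos h2, leadMat]
      rw [← coeff_mul_add_eq_of_natDegree_le (by omega) (natDegree_le_rowDeg G i j),
        Nat.sub_add_cancel h2]
  have hc : c ≠ 0 := fun h => by
    have h1 := congrFun h m
    have hum : u m ≠ 0 := by simpa [s] using hm
    simp only [c, hd, Nat.add_sub_cancel_right, Pi.zero_apply, coeff_natDegree] at h1
    rw [if_pos (by omega)] at h1
    exact hum (leadingCoeff_eq_zero.1 h1)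
  refine (hmax i₀ (by simpa [s] using hi₀)).trans ?_
  by_contra! hlt
  rw [coeffVec_eq_zero_of_degP_lt hlt] at hco
  exact hc (eq_zero_of_vecMul_leadMat hb hr hco.symm)

theorem PredictableDegree.eq_zero {k n : ℕ} {G : Matrix (Fin k) (Fin n) F[X]}
    (hG : PredictableDegree G) {u : Fin k → F[X]} (hu : u ᵥ* G = 0) : u = 0 := by
  ext1 i
  by_contra hi
  have h0 : (X : F[X]) * u i ≠ 0 := mul_ne_zero X_ne_zero hi
  have h1 := hG ((X : F[X]) • u) i h0
  rw [Matrix.smul_vecMul, hu, smul_zero, Pi.smul_apply, smul_eq_mul,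
    natDegree_X_mul hi] at h1
  have h2 : degP (0 : Fin n → F[X]) = 0 := by simp [degP]
  omega

/-! ### The Forney indices -/

theorem vecMul_mem {k n : ℕ} {G : Matrix (Fin k) (Fin n) F[X]}
    {C : Submodule F[X] (Fin n → F[X])} (hC : (C : Set (Fin n → F[X])) = codeOf G)
    (u : Fin k → F[X]) : u ᵥ* G ∈ C := by
  change _ ∈ (C : Set (Fin n → F[X]))
  rw [hC]
  exact ⟨u, rfl⟩

theorem exists_vecMul_eq {k n : ℕ} {G : Matrix (Fin k) (Fin n) F[X]}
    {C : Submodule F[X] (Fin n → F[X])} (hC : (C : Set (Fin n → F[X])) = codeOf G)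
    {v : Fin n → F[X]} (hv : v ∈ C) : ∃ u : Fin k → F[X], u ᵥ* G = v := by
  change _ ∈ (C : Set (Fin n → F[X])) at hv
  rwa [hC] at hv

theorem row_mem {k n : ℕ} {G : Matrix (Fin k) (Fin n) F[X]}
    {C : Submodule F[X] (Fin n → F[X])} (hC : (C : Set (Fin n → F[X])) = codeOf G)
    (i : Fin k) : G i ∈ C := by
  have := vecMul_mem hC (Pi.single i 1)
  rwa [Matrix.single_one_vecMul] at this

theorem card_rowDeg_eq_zero_le {k n : ℕ} {G H : Matrix (Fin k) (Fin n) F[X]}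
    {Q : Submodule F[X] (Fin n → F[X])} (hG : PredictableDegree G) (hH : PredictableDegree H)
    (hCG : (Q : Set (Fin n → F[X])) = codeOf G) (hCH : (Q : Set (Fin n → F[X])) = codeOf H) :
    Fintype.card {i // rowDeg G i = 0} ≤ Fintype.card {i // rowDeg H i = 0} := by
  choose U hU using fun i => exists_vecMul_eq hCH (row_mem hCG i)
  have hdeg : ∀ i : {i // rowDeg G i = 0}, ∀ j, U i j ≠ 0 →
      (U i j).natDegree = 0 ∧ rowDeg H j = 0 := by
    intro i j hj
    have h1 := hH (U i) j hj
    rw [hU] at h1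
    have h2 : degP (G i) = 0 := i.2
    omega
  let P : Matrix {i // rowDeg G i = 0} {j // rowDeg H j = 0} F := fun i j => (U i j).coeff 0
  have hinj : Function.Injective (Matrix.vecMulLinear P) := by
    rw [injective_iff_map_eq_zero]
    intro c hc
    let c' : Fin k → F[X] := fun i => if h : rowDeg G i = 0 then C (c ⟨i, h⟩) else 0
    have hsum : ∀ f : Fin k → F[X], ∑ i, c' i * f i =
        ∑ i : {i // rowDeg G i = 0}, C (c i) * f i := by
      intro f
      rw [← Finset.sum_subset (Finset.subset_univ (Finset.univ.filter fun i => rowDeg G i = 0)),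
        Finset.sum_subtype _ (p := fun i => rowDeg G i = 0) (by simp)]
      · exact Finset.sum_congr rfl fun i _ => by simp only [c', dif_pos i.2]
      · intro i _ hi
        simp only [c', dif_neg (by simpa using hi), zero_mul]
    have h0 : c' ᵥ* G = 0 := by
      have h1 : c' ᵥ* G = (c' ᵥ* (Matrix.of U)) ᵥ* H := by
        rw [Matrix.vecMul_vecMul]
        congr 1
        exact funext fun i => (hU i).symm
      have h2 : c' ᵥ* (Matrix.of U) = 0 := by
        ext1 j
        change ∑ i, c' i * U i j = 0
        rw [hsum fun i => U i j]
        by_cases hj : rowDeg H j = 0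
        · have h3 : ∑ i : {i // rowDeg G i = 0}, c i * (U i j).coeff 0 = 0 := congrFun hc ⟨j, hj⟩
          rw [← C_0, ← h3, map_sum]
          refine Finset.sum_congr rfl fun i _ => ?_
          rw [C_mul]
          congr 1
          by_cases h : U i j = 0
          · simp [h]
          · exact eq_C_of_natDegree_eq_zero (hdeg i j h).1
        · refine Finset.sum_eq_zero fun i _ => ?_
          by_contra h
          exact hj (hdeg i j (right_ne_zero_of_mul h)).2
      rw [h1, h2, Matrix.zero_vecMul]
    ext i
    have h1 := congrFun (hG.eq_zero h0) i
    simpa [c', i.2] using h1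
  simpa using LinearMap.finrank_le_finrank_of_injective hinj

theorem exists_rowDeg_eq_of_ncard_le_one {k n δ : ℕ} (hδ : 0 < δ)
    {G H : Matrix (Fin k) (Fin n) F[X]}
    {C : Submodule F[X] (Fin n → F[X])} (hG : PredictableDegree G) (hH : PredictableDegree H)
    (hCG : (C : Set (Fin n → F[X])) = codeOf G) (hCH : (C : Set (Fin n → F[X])) = codeOf H)
    (hle : {i | 0 < rowDeg G i}.ncard ≤ 1) (hs : ∑ i, rowDeg H i = δ) :
    ∃ i₀, rowDeg H i₀ = δ ∧ ∀ i, i ≠ i₀ → rowDeg H i = 0 := by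
  classical
  have h1 := card_rowDeg_eq_zero_le hG hH hCG hCH
  rw [Set.ncard_eq_toFinset_card', Set.toFinset_ofPred] at hle
  rw [Fintype.card_subtype, Fintype.card_subtype] at h1
  have h2 := Finset.card_filter_add_card_filter_not (s := Finset.univ) fun i => rowDeg G i = 0
  have h3 := Finset.card_filter_add_card_filter_not (s := Finset.univ) fun i => rowDeg H i = 0
  simp only [Nat.pos_iff_ne_zero, ne_eq] at hle
  have h4 : (Finset.univ.filter fun i => ¬ rowDeg H i = 0).card ≤ 1 := by
    omega
  obtain ⟨i₀, hi₀⟩ : ∃ i, rowDeg H i ≠ 0 := by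
    by_contra! h
    simp [h] at hs
    omega
  have h5 : ∀ i, i ≠ i₀ → rowDeg H i = 0 := by
    intro i hi
    by_contra h
    exact hi (Finset.card_le_one.1 h4 i (by simpa using h) i₀ (by simpa using hi₀))
  refine ⟨i₀, ?_, h5⟩
  rw [← hs, Finset.sum_eq_single i₀ (fun i _ hi => h5 i hi) (by simp)]

/-! ### State space isomorphisms commuting with the shift transition are scalar -/

theorem toeplitz_of_boundary_eq_zero {m : ℕ} (t : ℕ → ℕ → F)
    (h : ∀ i j, i < m → j < m → t (i + 1) (j + 1) = t i j) (hr : ∀ j, j < m → t m j = 0)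
    (hc : ∀ j, j < m → t 0 (j + 1) = 0) :
    ∀ i j, i ≤ m → j ≤ m → t i j = if i = j then t 0 0 else 0 := by
  have hdown : ∀ r i j, i + r ≤ m → j + r ≤ m → t (i + r) (j + r) = t i j := by
    intro r
    induction r with
    | zero => intros; rfl
    | succ r ih =>
      intro i j hi hj
      rw [← ih i j (by omega) (by omega), ← h (i + r) (j + r) (by omega) (by omega)]
      rfl
  intro i j hi hj
  rcases lt_trichotomy i j with hij | rfl | hij
  · have := hdown i 0 (j - i) (by omega) (by omega)
    rw [Nat.zero_add, Nat.sub_add_cancel hij.le] at this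
    rw [if_neg hij.ne, this, show j - i = (j - i - 1) + 1 by omega, hc _ (by omega)]
  · simpa using hdown i 0 0 (by omega) (by omega)
  · have := hdown (m - i) i j (by omega) (by omega)
    rw [if_neg hij.ne', ← this, show i + (m - i) = m by omega, hr _ (by omega)]

theorem exists_scalar_of_shift_invariant {m : ℕ}
    (T : (Fin (m + 1) → F) ≃ₗ[F] (Fin (m + 1) → F))
    (h : ∀ x y, (∀ i : Fin m, y i.succ = x i.castSucc) →
      ∀ i : Fin m, T y i.succ = T x i.castSucc) :
    ∃ c : F, c ≠ 0 ∧ ∀ x, T x = c • x := by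
  let e : ℕ → Fin (m + 1) → F := fun i j => if (j : ℕ) = i then 1 else 0
  let t : ℕ → ℕ → F := fun i j => if hj : j < m + 1 then T (e i) ⟨j, hj⟩ else 0
  have ht := toeplitz_of_boundary_eq_zero (m := m) t ?_ ?_ ?_
  · have hT : ∀ x, T x = t 0 0 • x := by
      intro x
      have hx : x = ∑ i : Fin (m + 1), x i • e i := by
        ext j
        simp [e, Finset.sum_apply, Fin.val_inj]
      ext j
      conv_lhs => rw [hx]
      rw [map_sum, Finset.sum_apply, Finset.sum_eq_single j]
      · have := ht j j (by omega) (by omega)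
        rw [if_pos rfl] at this
        simp only [t, dif_pos j.2] at this
        rw [map_smul, Pi.smul_apply, this, Pi.smul_apply, smul_eq_mul, smul_eq_mul, mul_comm]
      · intro i _ hij
        have := ht i j (by omega) (by omega)
        rw [if_neg (by simpa [Fin.val_inj] using hij)] at this
        simp only [t, dif_pos j.2] at this
        simp [this]
      · simp
    refine ⟨t 0 0, fun h0 => ?_, hT⟩
    have h1 : T (e 0) = 0 := by rw [hT, h0, zero_smul]
    have h2 := congrFun (T.map_eq_zero_iff.1 h1) 0
    simp [e] at h2
  · intro i j hi hj
    have := h (e i) (e (i + 1)) (fun r => by simp [e]) ⟨j, hj⟩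
    simp only [t, dif_pos (show j + 1 < m + 1 by omega), dif_pos (show j < m + 1 by omega)]
    exact this
  · intro j hj
    have := h (e m) 0 (fun r => by simp [e, r.2.ne]) ⟨j, hj⟩
    simp only [t, dif_pos (show j < m + 1 by omega)]
    rw [map_zero] at this
    exact this.symm
  · intro j hj
    have := h 0 (e 0) (fun r => by simp [e]) ⟨j, hj⟩
    simp only [t, dif_pos (show j + 1 < m + 1 by omega)]
    rw [map_zero] at this
    exact this

/-! ### Weight sums over cosets -/

theorem sum_translate_range {V W A : Type*} [AddCommGroup V] [Fintype V] [AddCommGroup W]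
    [AddCommMonoid A] (L : V →+ W) (f : W → A) {y : W} (hy : y ∈ L.range) :
    ∑ u, f (y + L u) = ∑ u, f (L u) := by
  obtain ⟨s, rfl⟩ := hy
  rw [← Equiv.sum_comp (Equiv.addLeft s) fun u => f (L u)]
  simp

theorem sum_eq_of_range_eq {V W : Type*} [AddCommGroup V] [Fintype V] [AddCommGroup W]
    (L L' : V →+ W) (f : W → ℕ) (hL : L.range = L'.range) :
    ∑ u, f (L u) = ∑ u, f (L' u) := by
  have h1 : ∑ u', ∑ u, f (L' u' + L u) = ∑ u', ∑ u, f (L u) :=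
    Finset.sum_congr rfl fun u' _ => sum_translate_range L f (by rw [hL]; exact ⟨u', rfl⟩)
  have h2 : ∑ u, ∑ u', f (L u + L' u') = ∑ u, ∑ u', f (L' u') :=
    Finset.sum_congr rfl fun u _ => sum_translate_range L' f (by rw [← hL]; exact ⟨u, rfl⟩)
  rw [Finset.sum_comm] at h2
  simp only [add_comm (L _) (L' _)] at h2
  rw [h1] at h2
  simp only [Finset.sum_const, smul_eq_mul] at h2
  exact Nat.eq_of_mul_eq_mul_left (Finset.card_pos.2 Finset.univ_nonempty) h2

theorem sum_coset_eq_of_range_eq {V W : Type*} [AddCommGroup V] [Fintype V] [AddCommGroup W]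
    (L L' : V →+ W) (f : W → ℕ) (hL : L.range = L'.range) {x x' : W} (hx : x - x' ∈ L.range) :
    ∑ u, f (x + L u) = ∑ u, f (x' + L' u) := by
  rw [← sum_eq_of_range_eq L L' (fun w => f (x' + w)) hL,
    ← sum_translate_range L (fun w => f (x' + w)) hx]
  refine Finset.sum_congr rfl fun u _ => congrArg f ?_
  abel

theorem sum_hammingNorm_smul_coset [Fintype F] [DecidableEq F] {V : Type*} [AddCommGroup V]
    [Module F V] [Fintype V] {n : ℕ} (L : V →ₗ[F] (Fin n → F)) {c : F} (hc : c ≠ 0)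
    (x : Fin n → F) :
    ∑ u, hammingNorm (c • x + L u) = ∑ u, hammingNorm (x + L u) := by
  rw [← Equiv.sum_comp (LinearEquiv.smulOfNeZero F V c hc).toEquiv]
  refine Finset.sum_congr rfl fun u _ => ?_
  simp only [LinearEquiv.coe_toEquiv, LinearEquiv.smulOfNeZero_apply, map_smul]
  rw [← smul_add, hammingNorm_smul fun _ => (isUnit_iff_ne_zero.2 hc).isSMulRegular F]

/-! ### Encoders with a single nonconstant row -/

/-- Combinations of the constant coefficients of the rows other than `i₀`. -/
def constPart {k n : ℕ} (G : Matrix (Fin k) (Fin n) F[X]) (i₀ : Fin k) :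
    (Fin k → F) →ₗ[F] (Fin n → F) :=
  Fintype.linearCombination F fun i => if i = i₀ then 0 else coeffVec (G i) 0

/-- Combinations of the first `δ + 1` coefficient vectors of the row `i₀`. -/
def windowPart {k n : ℕ} (G : Matrix (Fin k) (Fin n) F[X]) (i₀ : Fin k) (δ : ℕ) :
    (Fin (δ + 1) → F) →ₗ[F] (Fin n → F) :=
  Fintype.linearCombination F fun l : Fin (δ + 1) => coeffVec (G i₀) l

theorem constPart_apply {k n : ℕ} (G : Matrix (Fin k) (Fin n) F[X]) (i₀ : Fin k) (u : Fin k → F)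
    (j : Fin n) : constPart G i₀ u j = ∑ i, u i * if i = i₀ then 0 else (G i j).coeff 0 := by
  simp only [constPart, Fintype.linearCombination_apply, Finset.sum_apply, Pi.smul_apply,
    smul_eq_mul]
  refine Finset.sum_congr rfl fun i _ => ?_
  split_ifs <;> rfl

theorem windowPart_apply {k n : ℕ} (G : Matrix (Fin k) (Fin n) F[X]) (i₀ : Fin k) (δ : ℕ)
    (w : Fin (δ + 1) → F) (j : Fin n) :
    windowPart G i₀ δ w j = ∑ l : Fin (δ + 1), w l * (G i₀ j).coeff l := by
  simp [windowPart, Fintype.linearCombination_apply, Finset.sum_apply, coeffVec]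

theorem eq_C_of_rowDeg_eq_zero {k n : ℕ} {G : Matrix (Fin k) (Fin n) F[X]} {i : Fin k}
    (h : rowDeg G i = 0) (j : Fin n) : G i j = C ((G i j).coeff 0) :=
  eq_C_of_natDegree_eq_zero (Nat.le_zero.1 (h ▸ natDegree_le_rowDeg G i j))

/-- An input whose codeword has, at time `δ`, the coefficient vector given by the window `w` of
the row `i₀` and the inputs `u` of the other rows; `u` affects no other time. -/
noncomputable def windowInput {k : ℕ} (i₀ : Fin k) (δ : ℕ) (w : Fin (δ + 1) → F)
    (u : Fin k → F) : Fin k → F[X] := fun i =>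
  if i = i₀ then ∑ l : Fin (δ + 1), monomial (δ - l) (w l) else monomial δ (u i)

theorem coeffVec_windowInput_self {k n δ : ℕ} (G : Matrix (Fin k) (Fin n) F[X]) (i₀ : Fin k)
    (w : Fin (δ + 1) → F) (u : Fin k → F) :
    coeffVec (windowInput i₀ δ w u ᵥ* G) δ = windowPart G i₀ δ w + constPart G i₀ u := by
  ext j
  rw [coeffVec_vecMul, Pi.add_apply, windowPart_apply, constPart_apply,
    ← Finset.add_sum_erase _ _ (Finset.mem_univ i₀),
    ← Finset.add_sum_erase _ (fun i => u i * _) (Finset.mem_univ i₀)]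
  simp only [windowInput, if_true, mul_zero, zero_add]
  congr 1
  · rw [Finset.sum_mul, finsetSum_coeff]
    refine Finset.sum_congr rfl fun l _ => ?_
    have := coeff_monomial_mul (G i₀ j) (δ - l) l (w l)
    rwa [Nat.add_sub_cancel' (by omega)] at this
  · refine Finset.sum_congr rfl fun i hi => ?_
    rw [if_neg (Finset.ne_of_mem_erase hi), if_neg (Finset.ne_of_mem_erase hi)]
    simpa using coeff_monomial_mul (G i j) δ 0 (u i)

theorem coeffVec_windowInput_of_ne {k n δ t : ℕ} {G : Matrix (Fin k) (Fin n) F[X]} {i₀ : Fin k}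
    (hν : ∀ i, i ≠ i₀ → rowDeg G i = 0) (ht : t ≠ δ) (w : Fin (δ + 1) → F) (u : Fin k → F) :
    coeffVec (windowInput i₀ δ w u ᵥ* G) t = coeffVec (windowInput i₀ δ w 0 ᵥ* G) t := by
  ext j
  rw [coeffVec_vecMul, coeffVec_vecMul]
  refine Finset.sum_congr rfl fun i _ => ?_
  by_cases hi : i = i₀
  · simp [windowInput, hi]
  · rw [eq_C_of_rowDeg_eq_zero (hν i hi) j]
    simp [windowInput, hi, coeff_monomial, ht.symm]

theorem wtP_windowInput [DecidableEq F] {k n δ : ℕ} {G : Matrix (Fin k) (Fin n) F[X]} {i₀ : Fin k}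
    (hν : ∀ i, i ≠ i₀ → rowDeg G i = 0) (w : Fin (δ + 1) → F) (u : Fin k → F) :
    wtP (windowInput i₀ δ w u ᵥ* G) + hammingNorm (windowPart G i₀ δ w) =
      wtP (windowInput i₀ δ w 0 ᵥ* G) +
        hammingNorm (windowPart G i₀ δ w + constPart G i₀ u) := by
  obtain ⟨N, hN⟩ : ∃ N, N = degP (windowInput i₀ δ w u ᵥ* G) +
    degP (windowInput i₀ δ w 0 ᵥ* G) + δ + 1 := ⟨_, rfl⟩
  have hmem : δ ∈ Finset.range N := Finset.mem_range.2 (by omega)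
  rw [wtP_eq_sum_hammingNorm (N := N) (by omega), wtP_eq_sum_hammingNorm (N := N) (by omega),
    ← Finset.add_sum_erase _ _ hmem, ← Finset.add_sum_erase _ _ hmem,
    coeffVec_windowInput_self, coeffVec_windowInput_self, map_zero, add_zero]
  rw [Finset.sum_congr rfl fun t ht => congrArg hammingNorm
    (coeffVec_windowInput_of_ne hν (Finset.ne_of_mem_erase ht) w u)]
  ring

theorem mem_range_constPart_iff {k n δ : ℕ} (hδ : 0 < δ) {G : Matrix (Fin k) (Fin n) F[X]}
    {Q : Submodule F[X] (Fin n → F[X])} (hG : PredictableDegree G)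
    (hQ : (Q : Set (Fin n → F[X])) = codeOf G) {i₀ : Fin k} (hν₀ : rowDeg G i₀ = δ)
    (hν : ∀ i, i ≠ i₀ → rowDeg G i = 0) (x : Fin n → F) :
    x ∈ LinearMap.range (constPart G i₀) ↔ (fun j => C (x j)) ∈ Q := by
  constructor
  · rintro ⟨u, rfl⟩
    convert vecMul_mem hQ fun i => if i = i₀ then 0 else C (u i) using 1
    ext1 j
    rw [constPart_apply, map_sum]
    refine Finset.sum_congr rfl fun i _ => ?_
    change C (u i * _) = (if i = i₀ then 0 else C (u i)) * G i j
    by_cases hi : i = i₀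
    · simp [hi]
    · rw [if_neg hi, if_neg hi, C_mul, ← eq_C_of_rowDeg_eq_zero (hν i hi)]
  · intro hx
    obtain ⟨U, hU⟩ := exists_vecMul_eq hQ hx
    have hdeg : degP (fun j => C (x j)) = 0 := by simp [degP]
    have h0 : U i₀ = 0 := by
      by_contra h
      have := hG U i₀ h
      rw [hU, hdeg] at this
      omega
    refine ⟨fun i => (U i).coeff 0, ?_⟩
    ext j
    have h1 : coeffVec (U ᵥ* G) 0 j = x j := by rw [hU]; simp [coeffVec]
    rw [constPart_apply, ← h1, coeffVec_vecMul]
    refine Finset.sum_congr rfl fun i _ => ?_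
    by_cases hi : i = i₀
    · simp [hi, h0]
    · rw [if_neg hi, mul_coeff_zero]

theorem exists_coeffVec_sub_smul_mem_range {k n δ : ℕ} {G : Matrix (Fin k) (Fin n) F[X]}
    {Q : Submodule F[X] (Fin n → F[X])} (hG : PredictableDegree G)
    (hQ : (Q : Set (Fin n → F[X])) = codeOf G) {i₀ : Fin k} (hν₀ : rowDeg G i₀ = δ)
    (hν : ∀ i, i ≠ i₀ → rowDeg G i = 0) {v : Fin n → F[X]} (hv : v ∈ Q) (hd : degP v ≤ δ) :
    ∃ b : F, ∀ t, coeffVec v t - b • coeffVec (G i₀) t ∈ LinearMap.range (constPart G i₀) := by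
  obtain ⟨U, rfl⟩ := exists_vecMul_eq hQ hv
  have h0 : U i₀ = C ((U i₀).coeff 0) := by
    by_cases h : U i₀ = 0
    · simp [h]
    · have := hG U i₀ h
      exact eq_C_of_natDegree_eq_zero (by omega)
  refine ⟨(U i₀).coeff 0, fun t => ⟨fun i => (U i).coeff t, ?_⟩⟩
  ext j
  rw [constPart_apply, Pi.sub_apply, coeffVec_vecMul, Pi.smul_apply, smul_eq_mul, eq_sub_iff_add_eq,
    ← Finset.add_sum_erase _ _ (Finset.mem_univ i₀),
    ← Finset.add_sum_erase _ (fun i => (U i * G i j).coeff t) (Finset.mem_univ i₀), if_pos rfl,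
    mul_zero, zero_add, add_comm]
  congr 1
  · rw [h0, coeff_C_mul, coeff_C_zero]
    rfl
  · refine Finset.sum_congr rfl fun i hi => ?_
    rw [eq_C_of_rowDeg_eq_zero (hν i (Finset.ne_of_mem_erase hi)) j, coeff_mul_C,
      if_neg (Finset.ne_of_mem_erase hi), coeff_C_zero]

theorem coeffVec_notMem_range_constPart {k n δ : ℕ} (hδ : 0 < δ) {G : Matrix (Fin k) (Fin n) F[X]}
    (hG : PredictableDegree G) {i₀ : Fin k} (hν₀ : rowDeg G i₀ = δ)
    (hν : ∀ i, i ≠ i₀ → rowDeg G i = 0) :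
    coeffVec (G i₀) δ ∉ LinearMap.range (constPart G i₀) := by
  rintro ⟨q, hq⟩
  let U : Fin k → F[X] := fun i => if i = i₀ then 1 else monomial δ (-q i)
  have h1 := hG U i₀ (by simp [U])
  have h2 : degP (U ᵥ* G) ≤ δ - 1 := by
    refine degP_le_iff.2 fun t ht => ?_
    ext j
    rw [coeffVec_vecMul, ← Finset.add_sum_erase _ _ (Finset.mem_univ i₀)]
    have h3 := congrFun hq j
    rw [constPart_apply, ← Finset.add_sum_erase _ _ (Finset.mem_univ i₀), if_pos rfl, mul_zero,
      zero_add] at h3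
    have h4 : ∀ i ∈ Finset.univ.erase i₀, (U i * G i j).coeff t =
        if t = δ then -(q i * if i = i₀ then 0 else (G i j).coeff 0) else 0 := by
      intro i hi
      rw [if_neg (Finset.ne_of_mem_erase hi)]
      conv_lhs => rw [eq_C_of_rowDeg_eq_zero (hν i (Finset.ne_of_mem_erase hi)) j]
      simp only [U, if_neg (Finset.ne_of_mem_erase hi), coeff_mul_C, coeff_monomial,
        eq_comm (a := δ)]
      split_ifs <;> ring
    rw [Finset.sum_congr rfl h4]
    simp only [U, if_true, one_mul, Pi.zero_apply]
    by_cases ht' : t = δ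
    · simp only [if_pos ht', Finset.sum_neg_distrib]
      rw [h3, ht']
      exact add_neg_cancel _
    · simp only [if_neg ht', Finset.sum_const_zero, add_zero]
      exact coeff_eq_zero_of_natDegree_lt
        (lt_of_le_of_lt (natDegree_le_rowDeg G i₀ j) (by omega))
  omega

/-! ### The weight adjacency matrix -/

theorem stateEnc_val {k δ : ℕ} {ν : Fin k → ℕ} {i₀ : Fin k} (hν : ∀ i, i ≠ i₀ → ν i = 0)
    (h : ∑ i, ν i = δ) (p : StateIdx ν) : p.1 = i₀ ∧ (stateEnc ν h p : ℕ) = p.2 := by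
  have h1 : p.1 = i₀ := by
    by_contra hp
    exact absurd p.2.2 (by simp [hν _ hp])
  refine ⟨h1, ?_⟩
  change (∑ i' ∈ Finset.univ.filter (fun i' => i' < p.1), ν i') + (p.2 : ℕ) = p.2
  rw [Finset.sum_eq_zero, zero_add]
  intro i hi
  refine hν i (ne_of_lt ?_)
  simpa [h1] using hi

theorem stateEnc_bijective {k δ : ℕ} {ν : Fin k → ℕ} {i₀ : Fin k} (hν₀ : ν i₀ = δ)
    (hν : ∀ i, i ≠ i₀ → ν i = 0) (h : ∑ i, ν i = δ) : Function.Bijective (stateEnc ν h) := by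
  constructor
  · rintro ⟨i, s⟩ ⟨i', s'⟩ hp
    have h1 := stateEnc_val hν h ⟨i, s⟩
    have h2 := stateEnc_val hν h ⟨i', s'⟩
    obtain rfl : i = i' := h1.1.trans h2.1.symm
    rw [hp, h2.2] at h1
    have : s' = s := Fin.ext h1.2
    rw [this]
  · intro t
    refine ⟨⟨i₀, ⟨t, hν₀ ▸ t.2⟩⟩, Fin.ext (stateEnc_val hν h _).2⟩

theorem ccf_transition_iff {k m : ℕ} {ν : Fin k → ℕ} {i₀ : Fin k} (hν₀ : ν i₀ = m + 1)
    (hν : ∀ i, i ≠ i₀ → ν i = 0) (h : ∑ i, ν i = m + 1) (x y : Fin (m + 1) → F) (u : Fin k → F) :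
    ((fun p => x (stateEnc ν h p)) ᵥ* ccfA ν + u ᵥ* ccfB ν = fun p => y (stateEnc ν h p)) ↔
      u i₀ = y 0 ∧ ∀ i : Fin m, y i.succ = x i.castSucc := by
  have hbij := stateEnc_bijective hν₀ hν h
  have hA : ∀ q, ((fun p => x (stateEnc ν h p)) ᵥ* ccfA ν) q =
      ∑ s : Fin (m + 1), x s * if (stateEnc ν h q : ℕ) = s + 1 then 1 else 0 := by
    intro q
    rw [← (Equiv.ofBijective _ hbij).sum_comp]
    refine Finset.sum_congr rfl fun p _ => ?_
    have hp := stateEnc_val hν h p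
    have hq := stateEnc_val hν h q
    simp only [Equiv.ofBijective_apply, ccfA, hp.2, hq.2, hp.1, hq.1, true_and]
  have hB : ∀ q, (u ᵥ* ccfB ν) q = if (stateEnc ν h q : ℕ) = 0 then u i₀ else 0 := by
    intro q
    have hq := stateEnc_val hν h q
    simp only [Matrix.vecMul, dotProduct, ccfB, hq.2, hq.1]
    rw [Finset.sum_eq_single i₀ (fun i _ hi => by simp [hi]) (by simp)]
    simp
  have key : ((fun p => x (stateEnc ν h p)) ᵥ* ccfA ν + u ᵥ* ccfB ν =
      fun p => y (stateEnc ν h p)) ↔ ∀ t : Fin (m + 1),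
        (∑ s : Fin (m + 1), x s * if (t : ℕ) = s + 1 then 1 else 0) +
          (if (t : ℕ) = 0 then u i₀ else 0) = y t := by
    rw [funext_iff, hbij.2.forall]
    refine forall_congr' fun q => ?_
    rw [Pi.add_apply, hA, hB]
  rw [key, Fin.forall_fin_succ]
  refine and_congr (by simp) (forall_congr' fun i => ?_)
  rw [Finset.sum_eq_single i.castSucc]
  · simp [eq_comm]
  · intro s _ hs
    rw [if_neg, mul_zero]
    intro h
    exact hs (Fin.ext (by simpa using h.symm))
  · simp

theorem ccf_output {k n m : ℕ} {G : Matrix (Fin k) (Fin n) F[X]} {i₀ : Fin k}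
    (hν₀ : rowDeg G i₀ = m + 1) (hν : ∀ i, i ≠ i₀ → rowDeg G i = 0)
    (h : ∑ i, rowDeg G i = m + 1) (x : Fin (m + 1) → F) (u : Fin k → F) :
    (fun p => x (stateEnc (rowDeg G) h p)) ᵥ* ccfC G + u ᵥ* ccfD G =
      windowPart G i₀ (m + 1) (Fin.cons (u i₀) x) + constPart G i₀ u := by
  have hbij := stateEnc_bijective hν₀ hν h
  ext j
  have hC : ((fun p => x (stateEnc (rowDeg G) h p)) ᵥ* ccfC G) j =
      ∑ s : Fin (m + 1), x s * (G i₀ j).coeff (s + 1) := by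
    rw [← (Equiv.ofBijective _ hbij).sum_comp]
    refine Finset.sum_congr rfl fun p _ => ?_
    have hp := stateEnc_val hν h p
    simp only [Equiv.ofBijective_apply, ccfC, hp.2, hp.1]
  rw [Pi.add_apply, Pi.add_apply, hC, constPart_apply]
  have hD : (u ᵥ* ccfD G) j = u i₀ * (G i₀ j).coeff 0 +
      ∑ i, u i * if i = i₀ then 0 else (G i j).coeff 0 := by
    rw [← Finset.add_sum_erase _ _ (Finset.mem_univ i₀), if_pos rfl, mul_zero, zero_add]
    change ∑ i, u i * (G i j).coeff 0 = _
    rw [← Finset.add_sum_erase _ _ (Finset.mem_univ i₀)]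
    congr 1
    refine Finset.sum_congr rfl fun i hi => ?_
    rw [if_neg (Finset.ne_of_mem_erase hi)]
  have hW : windowPart G i₀ (m + 1) (Fin.cons (u i₀) x) j =
      u i₀ * (G i₀ j).coeff 0 + ∑ s : Fin (m + 1), x s * (G i₀ j).coeff (s + 1) := by
    rw [windowPart_apply, Fin.sum_univ_succ]
    rfl
  rw [hD, hW]
  ring

theorem WAMfin_eq_ncard [DecidableEq F] {k n m : ℕ} {G : Matrix (Fin k) (Fin n) F[X]} {i₀ : Fin k}
    (hν₀ : rowDeg G i₀ = m + 1) (hν : ∀ i, i ≠ i₀ → rowDeg G i = 0)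
    (h : ∑ i, rowDeg G i = m + 1) (x y : Fin (m + 1) → F) (w : ℕ) :
    WAMfin G h x y w = Set.ncard {u : Fin k → F |
      (u i₀ = y 0 ∧ ∀ i : Fin m, y i.succ = x i.castSucc) ∧
        hammingNorm (windowPart G i₀ (m + 1) (Fin.cons (u i₀) x) + constPart G i₀ u) = w} := by
  simp only [WAMfin, WAMe, ccf_transition_iff hν₀ hν, ccf_output hν₀ hν]

theorem exists_scalar_of_WAMfin_eq [Finite F] [DecidableEq F] {k n m : ℕ}
    {G H : Matrix (Fin k) (Fin n) F[X]} {i₀ i₁ : Fin k}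
    (hG₀ : rowDeg G i₀ = m + 1) (hG : ∀ i, i ≠ i₀ → rowDeg G i = 0)
    (hH₀ : rowDeg H i₁ = m + 1) (hH : ∀ i, i ≠ i₁ → rowDeg H i = 0)
    (hsG : ∑ i, rowDeg G i = m + 1) (hsH : ∑ i, rowDeg H i = m + 1)
    (T : (Fin (m + 1) → F) ≃ₗ[F] (Fin (m + 1) → F))
    (hT : ∀ x y w, WAMfin G hsG x y w = WAMfin H hsH (T x) (T y) w) :
    ∃ c : F, c ≠ 0 ∧ ∀ x, T x = c • x := by
  refine exists_scalar_of_shift_invariant T fun x y hxy => ?_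
  have h := hT x y (hammingNorm (windowPart G i₀ (m + 1)
    (Fin.cons ((Pi.single i₀ (y 0) : Fin k → F) i₀) x) + constPart G i₀ (Pi.single i₀ (y 0))))
  rw [WAMfin_eq_ncard hG₀ hG, WAMfin_eq_ncard hH₀ hH] at h
  have hne := ne_of_eq_of_ne h.symm (Set.ncard_ne_zero_of_mem
    (a := Pi.single i₀ (y 0)) ⟨⟨by simp, hxy⟩, rfl⟩ (Set.toFinite _))
  obtain ⟨u, hu, -⟩ := Set.nonempty_of_ncard_ne_zero hne
  exact hu.2

theorem sum_eq_sum_of_card_fiber_eq {ι κ : Type*} (s : Finset ι) (t : Finset κ) (f : ι → ℕ)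
    (g : κ → ℕ) (h : ∀ w, (s.filter fun i => f i = w).card = (t.filter fun i => g i = w).card) :
    ∑ i ∈ s, f i = ∑ i ∈ t, g i := by
  have : s.val.map f = t.val.map g := by
    ext w
    rw [Multiset.count_map, Multiset.count_map]
    simp only [eq_comm (a := w)]
    exact h w
  exact congrArg Multiset.sum this

theorem sum_constPart_eq_card_mul [Fintype F] [DecidableEq F] {k n : ℕ}
    (G : Matrix (Fin k) (Fin n) F[X]) (i₀ : Fin k) (f : (Fin n → F) → ℕ) (a : F) :
    ∑ u, f (constPart G i₀ u) =
      Fintype.card F * ∑ u ∈ Finset.univ.filter (fun u : Fin k → F => u i₀ = a),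
        f (constPart G i₀ u) := by
  rw [← Finset.sum_fiberwise Finset.univ (fun u : Fin k → F => u i₀), ← Finset.card_univ,
    ← smul_eq_mul, ← Finset.sum_const]
  refine Finset.sum_congr rfl fun b _ => ?_
  refine Finset.sum_equiv (Equiv.addRight (Pi.single i₀ (a - b))) (fun u => ?_) fun u _ => ?_
  · simp only [Finset.mem_filter, Finset.mem_univ, true_and, Equiv.coe_addRight, Pi.add_apply,
      Pi.single_eq_same]
    constructor
    · rintro rfl
      ring
    · intro h
      linear_combination h
  · have h0 : constPart G i₀ (Pi.single i₀ (a - b)) = 0 := by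
      simp [constPart, Fintype.linearCombination_apply_single]
    rw [Equiv.coe_addRight, map_add, h0, add_zero]

theorem sum_hammingNorm_eq_of_WAMfin_eq [Fintype F] [DecidableEq F] {k n m : ℕ}
    {G H : Matrix (Fin k) (Fin n) F[X]} {i₀ i₁ : Fin k}
    (hG₀ : rowDeg G i₀ = m + 1) (hG : ∀ i, i ≠ i₀ → rowDeg G i = 0)
    (hH₀ : rowDeg H i₁ = m + 1) (hH : ∀ i, i ≠ i₁ → rowDeg H i = 0)
    (hsG : ∑ i, rowDeg G i = m + 1) (hsH : ∑ i, rowDeg H i = m + 1)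
    (T : (Fin (m + 1) → F) ≃ₗ[F] (Fin (m + 1) → F))
    (hT : ∀ x y w, WAMfin G hsG x y w = WAMfin H hsH (T x) (T y) w) (v : Fin (m + 2) → F) :
    ∑ u, hammingNorm (windowPart G i₀ (m + 1) v + constPart G i₀ u) =
      ∑ u, hammingNorm (windowPart H i₁ (m + 1) v + constPart H i₁ u) := by
  obtain ⟨c, hc, hTc⟩ := exists_scalar_of_WAMfin_eq hG₀ hG hH₀ hH hsG hsH T hT
  rw [← sum_hammingNorm_smul_coset (constPart H i₁) hc, ← map_smul,
    sum_constPart_eq_card_mul G i₀ (fun z => hammingNorm (windowPart G i₀ (m + 1) v + z)) (v 0),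
    sum_constPart_eq_card_mul H i₁
      (fun z => hammingNorm (windowPart H i₁ (m + 1) (c • v) + z)) (c * v 0)]
  congr 1
  refine sum_eq_sum_of_card_fiber_eq _ _ _ _ fun w => ?_
  let y : Fin (m + 1) → F := Fin.cons (v 0) fun i : Fin m => v i.succ.castSucc
  have h := hT (fun i => v i.succ) y w
  rw [WAMfin_eq_ncard hG₀ hG, WAMfin_eq_ncard hH₀ hH, hTc, hTc] at h
  rw [Finset.filter_filter, Finset.filter_filter, ← Set.ncard_coe_finset, ← Set.ncard_coe_finset]
  convert h using 2
  · ext u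
    simp only [Finset.coe_filter, Finset.mem_univ, true_and, Set.mem_ofPred_eq]
    have hy : ∀ i : Fin m, y i.succ = v i.castSucc.succ := fun i => rfl
    have hy0 : y 0 = v 0 := rfl
    simp only [hy, hy0, implies_true, and_true]
    refine and_congr_right fun hu => ?_
    rw [hu]
    congr! 4
    exact (Fin.cons_self_tail v).symm
  · ext u
    simp only [Finset.coe_filter, Finset.mem_univ, true_and, Set.mem_ofPred_eq]
    have hy : ∀ i : Fin m, y i.succ = v i.castSucc.succ := fun i => rfl
    have hy0 : y 0 = v 0 := rfl
    simp only [hy, hy0, implies_true, and_true, Pi.smul_apply, smul_eq_mul]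
    refine and_congr_right fun hu => ?_
    rw [hu]
    congr! 4
    exact (Fin.cons_self_tail (c • v)).symm

/-! ### From strong isometries and weight adjacency matrices to monomial equivalence -/

theorem exists_image_encoder [DecidableEq F] {k n : ℕ} {Q Q' : Submodule F[X] (Fin n → F[X])}
    {G : Matrix (Fin k) (Fin n) F[X]} (hQ : (Q : Set (Fin n → F[X])) = codeOf G)
    (φ : Q ≃ₗ[F[X]] Q')
    (hwt : ∀ v : Q, wtP (φ v : Fin n → F[X]) = wtP (v : Fin n → F[X]))
    (hdeg : ∀ v : Q, (v : Fin n → F[X]) ≠ 0 →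
      degP (φ v : Fin n → F[X]) = degP (v : Fin n → F[X])) :
    ∃ H : Matrix (Fin k) (Fin n) F[X], (Q' : Set (Fin n → F[X])) = codeOf H ∧
      (∀ u, wtP (u ᵥ* H) = wtP (u ᵥ* G)) ∧ ∀ u, degP (u ᵥ* H) = degP (u ᵥ* G) := by
  let H : Matrix (Fin k) (Fin n) F[X] := fun i => φ ⟨G i, row_mem hQ i⟩
  have hφ : ∀ u, (φ ⟨u ᵥ* G, vecMul_mem hQ u⟩ : Fin n → F[X]) = u ᵥ* H := by
    intro u
    have h1 : (⟨u ᵥ* G, vecMul_mem hQ u⟩ : Q) = ∑ i, u i • ⟨G i, row_mem hQ i⟩ := by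
      ext1
      rw [AddSubmonoidClass.coe_finsetSum]
      exact Matrix.vecMul_eq_sum u G
    rw [h1, map_sum, AddSubmonoidClass.coe_finsetSum, Matrix.vecMul_eq_sum]
    refine Finset.sum_congr rfl fun i _ => ?_
    rw [map_smul]
    rfl
  refine ⟨H, ?_, fun u => ?_, fun u => ?_⟩
  · ext v
    constructor
    · intro hv
      obtain ⟨u, hu⟩ := exists_vecMul_eq hQ (φ.symm ⟨v, hv⟩).2
      refine ⟨u, ?_⟩
      simp only [← hφ, hu, Subtype.coe_eta, LinearEquiv.apply_symm_apply]
    · rintro ⟨u, rfl⟩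
      simp only [← hφ]
      exact (φ _).2
  · rw [← hφ, hwt]
  · by_cases h0 : u ᵥ* G = 0
    · have h1 : (⟨u ᵥ* G, vecMul_mem hQ u⟩ : Q) = 0 := by
        ext1
        exact h0
      rw [← hφ, h1, map_zero, h0]
      rfl
    · rw [← hφ, hdeg ⟨u ᵥ* G, vecMul_mem hQ u⟩ h0]

theorem vecMul_map_C_coeffVec {n : ℕ} (v : Fin n → F[X]) (M : Matrix (Fin n) (Fin n) F) (t : ℕ) :
    coeffVec (v ᵥ* M.map C) t = coeffVec v t ᵥ* M := by
  ext j
  rw [coeffVec_vecMul]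
  exact Finset.sum_congr rfl fun i _ => coeff_mul_C _ _ _

theorem eq_image_of_coeffVec_eq {k n : ℕ} {Q Q' : Submodule F[X] (Fin n → F[X])}
    {G H : Matrix (Fin k) (Fin n) F[X]} (hQ : (Q : Set (Fin n → F[X])) = codeOf G)
    (hQ' : (Q' : Set (Fin n → F[X])) = codeOf H) (M : Matrix (Fin n) (Fin n) F)
    (h : ∀ i t, coeffVec (H i) t = coeffVec (G i) t ᵥ* M) :
    (Q' : Set (Fin n → F[X])) =
      (fun v : Fin n → F[X] => v ᵥ* M.map fun a => C a) '' (Q : Set (Fin n → F[X])) := by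
  have hH : H = G * M.map fun a => C a := by
    ext i j t
    have h1 := congrFun ((h i t).trans (vecMul_map_C_coeffVec (G i) M t).symm) j
    exact h1
  rw [hQ, hQ', codeOf, codeOf, ← Set.range_comp, hH]
  congr 1
  ext1 u
  exact (Matrix.vecMul_vecMul _ _ _).symm

theorem rowDeg_eq_of_degP_vecMul_eq {k n : ℕ} {G H : Matrix (Fin k) (Fin n) F[X]}
    (h : ∀ u, degP (u ᵥ* H) = degP (u ᵥ* G)) (i : Fin k) : rowDeg H i = rowDeg G i := by
  have := h (Pi.single i 1)
  rw [Matrix.single_one_vecMul, Matrix.single_one_vecMul] at this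
  exact this

/-- Blockwise weights agree for an encoder and its image under a strong isometry. -/
theorem hammingNorm_window_eq [Fintype F] [DecidableEq F] {k n m : ℕ}
    {Q' : Submodule F[X] (Fin n → F[X])} {G G' H : Matrix (Fin k) (Fin n) F[X]} {i₀ i₁ : Fin k}
    (hQG' : (Q' : Set (Fin n → F[X])) = codeOf G') (hQH : (Q' : Set (Fin n → F[X])) = codeOf H)
    (hG : PredictableDegree G) (hG' : PredictableDegree G')
    (hG₀ : rowDeg G i₀ = m + 1) (hGν : ∀ i, i ≠ i₀ → rowDeg G i = 0)
    (hG'₀ : rowDeg G' i₁ = m + 1) (hG'ν : ∀ i, i ≠ i₁ → rowDeg G' i = 0)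
    (hsG : ∑ i, rowDeg G i = m + 1) (hsG' : ∑ i, rowDeg G' i = m + 1)
    (T : (Fin (m + 1) → F) ≃ₗ[F] (Fin (m + 1) → F))
    (hT : ∀ x y w, WAMfin G hsG x y w = WAMfin G' hsG' (T x) (T y) w)
    (hwt : ∀ u, wtP (u ᵥ* H) = wtP (u ᵥ* G)) (hdeg : ∀ u, degP (u ᵥ* H) = degP (u ᵥ* G))
    (v : Fin (m + 2) → F) (u : Fin k → F) :
    hammingNorm (windowPart G i₀ (m + 1) v + constPart G i₀ u) =
      hammingNorm (windowPart H i₀ (m + 1) v + constPart H i₀ u) := by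
  have hr := rowDeg_eq_of_degP_vecMul_eq hdeg
  have hH₀ : rowDeg H i₀ = m + 1 := by rw [hr, hG₀]
  have hHν : ∀ i, i ≠ i₀ → rowDeg H i = 0 := fun i hi => by rw [hr, hGν i hi]
  have hH : PredictableDegree H := fun u i hi => by
    rw [hdeg, hr]
    exact hG u i hi
  have hrange : LinearMap.range (constPart G' i₁) = LinearMap.range (constPart H i₀) := by
    ext x
    rw [mem_range_constPart_iff m.succ_pos hG' hQG' hG'₀ hG'ν,
      mem_range_constPart_iff m.succ_pos hH hQH hH₀ hHν]
  obtain ⟨b, hb⟩ := exists_coeffVec_sub_smul_mem_range hG' hQG' hG'₀ hG'ν (row_mem hQH i₀) hH₀.le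
  have hb0 : b ≠ 0 := by
    rintro rfl
    have := hb (m + 1)
    rw [zero_smul, sub_zero, hrange] at this
    exact coeffVec_notMem_range_constPart m.succ_pos hH hH₀ hHν this
  have hsum : ∑ u, hammingNorm (windowPart G i₀ (m + 1) v + constPart G i₀ u) =
      ∑ u, hammingNorm (windowPart H i₀ (m + 1) v + constPart H i₀ u) := by
    rw [sum_hammingNorm_eq_of_WAMfin_eq hG₀ hGν hG'₀ hG'ν hsG hsG' T hT,
      ← sum_hammingNorm_smul_coset (constPart G' i₁) hb0]
    symm
    refine sum_coset_eq_of_range_eq (constPart H i₀).toAddMonoidHom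
      (constPart G' i₁).toAddMonoidHom hammingNorm ?_ ?_
    · ext x
      exact (SetLike.ext_iff.1 hrange x).symm
    · change _ ∈ LinearMap.range (constPart H i₀)
      rw [← hrange, windowPart, windowPart, Fintype.linearCombination_apply,
        Fintype.linearCombination_apply, Finset.smul_sum, ← Finset.sum_sub_distrib]
      refine Submodule.sum_mem _ fun l _ => ?_
      rw [smul_comm b, ← smul_sub]
      exact Submodule.smul_mem _ _ (hb l)
  have hdiff : ∀ u, hammingNorm (windowPart G i₀ (m + 1) v + constPart G i₀ u) +
      hammingNorm (windowPart H i₀ (m + 1) v) =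
        hammingNorm (windowPart H i₀ (m + 1) v + constPart H i₀ u) +
          hammingNorm (windowPart G i₀ (m + 1) v) := by
    intro u
    have h1 := wtP_windowInput hGν v u
    have h2 := wtP_windowInput hHν v u
    rw [hwt, hwt] at h2
    omega
  have hconst : hammingNorm (windowPart H i₀ (m + 1) v) =
      hammingNorm (windowPart G i₀ (m + 1) v) := by
    have := Finset.sum_congr (rfl : (Finset.univ : Finset (Fin k → F)) = _) fun u _ => hdiff u
    rw [Finset.sum_add_distrib, Finset.sum_add_distrib, hsum] at this
    have := Nat.add_left_cancel this
    simp only [Finset.sum_const, smul_eq_mul] at this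
    exact Nat.eq_of_mul_eq_mul_left (Finset.card_pos.2 Finset.univ_nonempty) this
  have := hdiff u
  omega

theorem coeffVec_C_vecMul {k n : ℕ} (u : Fin k → F) (G : Matrix (Fin k) (Fin n) F[X]) (t : ℕ) :
    coeffVec ((fun i => C (u i)) ᵥ* G) t =
      Fintype.linearCombination F (fun i => coeffVec (G i) t) u := by
  ext j
  rw [coeffVec_vecMul, Fintype.linearCombination_apply, Finset.sum_apply]
  exact Finset.sum_congr rfl fun i _ => coeff_C_mul _

theorem exists_monomial_of_constant [Finite F] [DecidableEq F] {k n : ℕ}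
    {G H : Matrix (Fin k) (Fin n) F[X]} (hν : ∀ i, rowDeg G i = 0)
    (hwt : ∀ u, wtP (u ᵥ* H) = wtP (u ᵥ* G)) (hdeg : ∀ u, degP (u ᵥ* H) = degP (u ᵥ* G)) :
    ∃ M : Matrix (Fin n) (Fin n) F, IsMonomialMatrix M ∧
      ∀ i t, coeffVec (H i) t = coeffVec (G i) t ᵥ* M := by
  have hr := rowDeg_eq_of_degP_vecMul_eq hdeg
  have hGt : ∀ i t, 0 < t → coeffVec (G i) t = 0 := fun i t ht =>
    coeffVec_eq_zero_of_degP_lt (lt_of_eq_of_lt (hν i) ht)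
  have hHt : ∀ i t, 0 < t → coeffVec (H i) t = 0 := fun i t ht =>
    coeffVec_eq_zero_of_degP_lt (lt_of_eq_of_lt ((hr i).trans (hν i)) ht)
  have hd : ∀ u : Fin k → F, degP ((fun i => C (u i)) ᵥ* G) = 0 := by
    intro u
    refine Nat.le_zero.1 (degP_le_iff.2 fun t ht => ?_)
    rw [coeffVec_C_vecMul, Fintype.linearCombination_apply]
    exact Finset.sum_eq_zero fun i _ => by rw [hGt i t ht, smul_zero]
  obtain ⟨M, hM, h⟩ := exists_monomial_of_hammingNorm_eq
    (Fintype.linearCombination F fun i => coeffVec (G i) 0)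
    (Fintype.linearCombination F fun i => coeffVec (H i) 0) fun u => by
      rw [← coeffVec_C_vecMul, ← coeffVec_C_vecMul,
        ← wtP_eq_hammingNorm_of_degP_eq_zero (hd u),
        ← wtP_eq_hammingNorm_of_degP_eq_zero ((hdeg _).trans (hd u)), hwt]
  refine ⟨M, hM, fun i t => ?_⟩
  rcases Nat.eq_zero_or_pos t with rfl | ht
  · simpa [Fintype.linearCombination_apply_single] using h (Pi.single i 1)
  · rw [hGt i t ht, hHt i t ht, Matrix.zero_vecMul]

theorem exists_monomial_of_window [Finite F] [DecidableEq F] {k n δ : ℕ}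
    {G H : Matrix (Fin k) (Fin n) F[X]} {i₀ : Fin k}
    (hG₀ : rowDeg G i₀ = δ) (hGν : ∀ i, i ≠ i₀ → rowDeg G i = 0)
    (hH₀ : rowDeg H i₀ = δ) (hHν : ∀ i, i ≠ i₀ → rowDeg H i = 0)
    (h : ∀ v u, hammingNorm (windowPart G i₀ δ v + constPart G i₀ u) =
      hammingNorm (windowPart H i₀ δ v + constPart H i₀ u)) :
    ∃ M : Matrix (Fin n) (Fin n) F, IsMonomialMatrix M ∧
      ∀ i t, coeffVec (H i) t = coeffVec (G i) t ᵥ* M := by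
  obtain ⟨M, hM, h⟩ := exists_monomial_of_hammingNorm_eq
    ((windowPart G i₀ δ).coprod (constPart G i₀))
    ((windowPart H i₀ δ).coprod (constPart H i₀)) fun x => h x.1 x.2
  refine ⟨M, hM, fun i t => ?_⟩
  by_cases hi : i = i₀
  · subst hi
    rcases Nat.lt_or_ge δ t with ht | ht
    · rw [coeffVec_eq_zero_of_degP_lt (lt_of_eq_of_lt hG₀ ht),
        coeffVec_eq_zero_of_degP_lt (lt_of_eq_of_lt hH₀ ht), Matrix.zero_vecMul]
    · have := h (Pi.single ⟨t, by omega⟩ 1, 0)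
      simpa [windowPart, Fintype.linearCombination_apply_single] using this
  · rcases Nat.eq_zero_or_pos t with rfl | ht
    · have := h (0, Pi.single i 1)
      simpa [constPart, Fintype.linearCombination_apply_single, hi] using this
    · rw [coeffVec_eq_zero_of_degP_lt (lt_of_eq_of_lt (hGν i hi) ht),
        coeffVec_eq_zero_of_degP_lt (lt_of_eq_of_lt (hHν i hi) ht), Matrix.zero_vecMul]

/-! ### Monomial transformations -/

theorem vecMul_monomial_apply {R : Type*} [CommRing R] {n : ℕ} (σ : Equiv.Perm (Fin n))
    (d : Fin n → R) (v : Fin n → R) (j : Fin n) :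
    (v ᵥ* Matrix.of fun i j => if σ i = j then d j else 0) j = v (σ.symm j) * d j := by
  change ∑ i, v i * (if σ i = j then d j else 0) = _
  rw [Finset.sum_eq_single (σ.symm j)]
  · rw [if_pos (σ.apply_symm_apply j)]
  · intro i _ hi
    rw [if_neg fun h => hi (by rw [← h, Equiv.symm_apply_apply]), mul_zero]
  · simp

theorem hammingNorm_vecMul_monomial [DecidableEq F] {n : ℕ} {M : Matrix (Fin n) (Fin n) F}
    (hM : IsMonomialMatrix M) (x : Fin n → F) : hammingNorm (x ᵥ* M) = hammingNorm x := by
  obtain ⟨σ, d, hd⟩ := hM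
  obtain rfl : M = Matrix.of fun i j => if σ i = j then (d j : F) else 0 := by
    ext i j
    exact hd i j
  refine Finset.card_equiv σ.symm fun j => ?_
  rw [Finset.mem_filter, Finset.mem_filter, vecMul_monomial_apply σ fun j => (d j : F)]
  simp

theorem degP_vecMul_monomial [DecidableEq F] {n : ℕ} {M : Matrix (Fin n) (Fin n) F}
    (hM : IsMonomialMatrix M) (v : Fin n → F[X]) : degP (v ᵥ* M.map C) = degP v := by
  refine eq_of_forall_ge_iff fun d => ?_
  rw [degP_le_iff, degP_le_iff]
  refine forall_congr' fun t => imp_congr_right fun _ => ?_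
  rw [vecMul_map_C_coeffVec, ← hammingNorm_eq_zero, hammingNorm_vecMul_monomial hM,
    hammingNorm_eq_zero]

theorem wtP_vecMul_monomial [DecidableEq F] {n : ℕ} {M : Matrix (Fin n) (Fin n) F}
    (hM : IsMonomialMatrix M) (v : Fin n → F[X]) : wtP (v ᵥ* M.map C) = wtP v := by
  rw [wtP_eq_sum_hammingNorm (N := degP v + 1) (by rw [degP_vecMul_monomial hM]; omega),
    wtP_eq_sum_hammingNorm (N := degP v + 1) (by omega)]
  refine Finset.sum_congr rfl fun t _ => ?_
  rw [vecMul_map_C_coeffVec, hammingNorm_vecMul_monomial hM]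

theorem isUnit_det_monomial {n : ℕ} {M : Matrix (Fin n) (Fin n) F} (hM : IsMonomialMatrix M) :
    IsUnit M.det := by
  classical
  rw [isUnit_iff_ne_zero]
  intro h0
  obtain ⟨v, hv, h⟩ := Matrix.exists_vecMul_eq_zero_iff.2 h0
  exact hv (by rw [← hammingNorm_eq_zero, ← hammingNorm_vecMul_monomial hM, h, hammingNorm_zero])

theorem isBasic_mul {k n : ℕ} {G : Matrix (Fin k) (Fin n) F[X]} (hG : IsBasic G)
    {M : Matrix (Fin n) (Fin n) F} (hM : IsUnit M.det) : IsBasic (G * M.map C) := by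
  intro lam
  have h1 : (G * M.map C).map (fun p => aeval lam p) =
      G.map (fun p => aeval lam p) * M.map (algebraMap F (AlgebraicClosure F)) := by
    ext i j
    simp [Matrix.mul_apply]
  rw [h1, Matrix.rank_mul_eq_left_of_isUnit_det, hG lam]
  rw [← RingHom.mapMatrix_apply, ← RingHom.map_det]
  exact hM.map _

theorem rowDeg_mul_monomial [DecidableEq F] {k n : ℕ} (G : Matrix (Fin k) (Fin n) F[X])
    {M : Matrix (Fin n) (Fin n) F} (hM : IsMonomialMatrix M) :
    rowDeg (G * M.map C) = rowDeg G :=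
  funext fun i => degP_vecMul_monomial hM (G i)

theorem degMat_mul_monomial {k n : ℕ} (G : Matrix (Fin k) (Fin n) F[X])
    {M : Matrix (Fin n) (Fin n) F} (hM : IsMonomialMatrix M) :
    degMat (G * M.map C) = degMat G := by
  obtain ⟨σ, d, hd⟩ := hM
  have hmap : M.map C = Matrix.of fun i j => if σ i = j then C (d j : F) else 0 := by
    ext1 i j
    rw [Matrix.map_apply, hd, Matrix.of_apply]
    split_ifs <;> simp
  have hminor : ∀ f : Fin k ↪ Fin n,
      (Matrix.det fun i i' => (G * M.map C) i (f i')).natDegree =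
        (Matrix.det fun i i' => G i (f.trans σ.symm.toEmbedding i')).natDegree := by
    intro f
    have h1 : (fun i i' => (G * M.map C) i (f i')) =
        Matrix.of fun i i' => C (d (f i') : F) * G i (f.trans σ.symm.toEmbedding i') := by
      ext1 i
      ext1 i'
      rw [hmap]
      exact (vecMul_monomial_apply σ (fun j => C (d j : F)) (G i) (f i')).trans (mul_comm _ _)
    rw [h1]
    refine (congrArg natDegree (Matrix.det_mul_row (fun i' => C (d (f i') : F))
      fun i i' => G i (f.trans σ.symm.toEmbedding i'))).trans ?_
    rw [← map_prod, natDegree_C_mul]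
    exact Finset.prod_ne_zero_iff.2 fun i' _ => (d (f i')).ne_zero
  refine le_antisymm (Finset.sup_le fun f _ => ?_) (Finset.sup_le fun f _ => ?_)
  · rw [hminor]
    exact Finset.le_sup (f := fun f : Fin k ↪ Fin n => (Matrix.det fun i i' => G i (f i')).natDegree)
      (Finset.mem_univ _)
  · have h1 : f = (f.trans σ.toEmbedding).trans σ.symm.toEmbedding := by
      ext i
      simp
    rw [h1, ← hminor]
    exact Finset.le_sup (f := fun f : Fin k ↪ Fin n =>
      (Matrix.det fun i i' => (G * M.map C) i (f i')).natDegree) (Finset.mem_univ _)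

/-- The weight adjacency matrix with the row degrees as an independent argument. -/
noncomputable def WAMof [DecidableEq F] {k n δ : ℕ} (ν : Fin k → ℕ)
    (G : Matrix (Fin k) (Fin n) F[X]) (h : ∑ i, ν i = δ) (x y : Fin δ → F) (w : ℕ) : ℕ :=
  Set.ncard {u : Fin k → F |
    (fun p => x (stateEnc ν h p)) ᵥ* ccfA ν + u ᵥ* ccfB ν = (fun p => y (stateEnc ν h p)) ∧
    hammingNorm ((fun p => x (stateEnc ν h p)) ᵥ*
      (Matrix.of fun (p : StateIdx ν) j => (G p.1 j).coeff ((p.2 : ℕ) + 1)) + u ᵥ* ccfD G) = w}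

theorem WAMof_congr [DecidableEq F] {k n δ : ℕ} {ν ν' : Fin k → ℕ} (hν : ν = ν')
    (G : Matrix (Fin k) (Fin n) F[X]) (h : ∑ i, ν i = δ) (h' : ∑ i, ν' i = δ)
    (x y : Fin δ → F) (w : ℕ) : WAMof ν G h x y w = WAMof ν' G h' x y w := by
  subst hν
  rfl

theorem WAMfin_mul_monomial [DecidableEq F] {k n δ : ℕ} (G : Matrix (Fin k) (Fin n) F[X])
    {M : Matrix (Fin n) (Fin n) F} (hM : IsMonomialMatrix M) (h : ∑ i, rowDeg G i = δ)
    (h' : ∑ i, rowDeg (G * M.map C) i = δ) (x y : Fin δ → F) (w : ℕ) :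
    WAMfin (G * M.map C) h' x y w = WAMfin G h x y w := by
  refine (WAMof_congr (rowDeg_mul_monomial G hM) (G * M.map C) h' h x y w).trans ?_
  change _ = WAMof (rowDeg G) G h x y w
  have hco : ∀ i j t, ((G * M.map C) i j).coeff t = ((fun j => (G i j).coeff t) ᵥ* M) j :=
    fun i j t => congrFun (vecMul_map_C_coeffVec (G i) M t) j
  have h1 : (Matrix.of fun (p : StateIdx (rowDeg G)) j =>
      ((G * M.map C) p.1 j).coeff ((p.2 : ℕ) + 1)) =
      (Matrix.of fun (p : StateIdx (rowDeg G)) j => (G p.1 j).coeff ((p.2 : ℕ) + 1)) * M := by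
    ext p j
    exact hco _ _ _
  have h2 : ccfD (G * M.map C) = ccfD G * M := by
    ext i j
    exact hco _ _ _
  simp only [WAMof, h1, h2, ← Matrix.vecMul_vecMul, ← Matrix.add_vecMul,
    hammingNorm_vecMul_monomial hM]

theorem vecMul_map_C_injective {n : ℕ} {M : Matrix (Fin n) (Fin n) F} (hM : IsMonomialMatrix M) :
    Function.Injective (Matrix.vecMulLinear (M.map (C : F →+* F[X]))) := by
  refine Matrix.vecMul_injective_of_isUnit ?_
  rw [Matrix.isUnit_iff_isUnit_det, ← RingHom.mapMatrix_apply, ← RingHom.map_det]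
  exact (isUnit_det_monomial hM).map _

/-- For convolutional codes of degree `δ` with at most one positive Forney index:
being strongly isometric with equal weight adjacency matrices (up to a state space
isomorphism `T`) is equivalent to monomial equivalence. -/
theorem stmt14 {F : Type*} [Field F] [Fintype F] [DecidableEq F] {k n δ : ℕ}
    (C C' : Submodule (Polynomial F) (Fin n → Polynomial F))
    (hC : ∃ G : Matrix (Fin k) (Fin n) (Polynomial F), IsBasic G ∧ IsRowReduced G ∧
      (C : Set (Fin n → Polynomial F)) = codeOf G ∧ degMat G = δ ∧
      ({i : Fin k | 0 < rowDeg G i}.ncard ≤ 1))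
    (hC' : ∃ G' : Matrix (Fin k) (Fin n) (Polynomial F), IsBasic G' ∧ IsRowReduced G' ∧
      (C' : Set (Fin n → Polynomial F)) = codeOf G' ∧ degMat G' = δ ∧
      ({i : Fin k | 0 < rowDeg G' i}.ncard ≤ 1)) :
    ((∃ φ : C ≃ₗ[Polynomial F] C',
        (∀ v : C, wtP ((φ v : Fin n → Polynomial F)) = wtP (v : Fin n → Polynomial F)) ∧
        (∀ v : C, (v : Fin n → Polynomial F) ≠ 0 →
          degP ((φ v : Fin n → Polynomial F)) = degP (v : Fin n → Polynomial F))) ∧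
      (∃ (G G' : Matrix (Fin k) (Fin n) (Polynomial F)),
        IsBasic G ∧ IsRowReduced G ∧ (C : Set (Fin n → Polynomial F)) = codeOf G ∧
        IsBasic G' ∧ IsRowReduced G' ∧ (C' : Set (Fin n → Polynomial F)) = codeOf G' ∧
        ∃ (hdG : (∑ i, rowDeg G i) = δ) (hdG' : (∑ i, rowDeg G' i) = δ)
          (T : (Fin δ → F) ≃ₗ[F] (Fin δ → F)),
          ∀ (X Y : Fin δ → F) (w : ℕ),
            WAMfin G hdG X Y w = WAMfin G' hdG' (T X) (T Y) w))
    ↔ (∃ M : Matrix (Fin n) (Fin n) F, IsMonomialMatrix M ∧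
        (C' : Set (Fin n → Polynomial F)) =
          (fun v : Fin n → Polynomial F => v ᵥ* M.map (fun a => Polynomial.C a)) ''
            (C : Set (Fin n → Polynomial F))) := by
  constructor
  · rintro ⟨⟨φ, hwt, hdeg⟩, G, G', hGb, hGr, hG, hG'b, hG'r, hG', hsG, hsG', T, hT⟩
    obtain ⟨G₀, hG₀b, hG₀r, hG₀, -, hle⟩ := hC
    obtain ⟨G₀', hG₀'b, hG₀'r, hG₀', -, hle'⟩ := hC'
    obtain ⟨H, hH, hHwt, hHdeg⟩ := exists_image_encoder hG φ hwt hdeg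
    have hGp := predictableDegree_of_isRowReduced hGb hGr
    have hG'p := predictableDegree_of_isRowReduced hG'b hG'r
    suffices h : ∃ M : Matrix (Fin n) (Fin n) F, IsMonomialMatrix M ∧
        ∀ i t, coeffVec (H i) t = coeffVec (G i) t ᵥ* M by
      obtain ⟨M, hM, h⟩ := h
      exact ⟨M, hM, eq_image_of_coeffVec_eq hG hH M h⟩
    rcases δ with _ | m
    · exact exists_monomial_of_constant (by simpa using hsG) hHwt hHdeg
    · obtain ⟨i₀, hi₀, hν⟩ := exists_rowDeg_eq_of_ncard_le_one m.succ_pos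
        (predictableDegree_of_isRowReduced hG₀b hG₀r) hGp hG₀ hG hle hsG
      obtain ⟨i₁, hi₁, hν'⟩ := exists_rowDeg_eq_of_ncard_le_one m.succ_pos
        (predictableDegree_of_isRowReduced hG₀'b hG₀'r) hG'p hG₀' hG' hle' hsG'
      have hr := rowDeg_eq_of_degP_vecMul_eq hHdeg
      exact exists_monomial_of_window hi₀ hν ((hr i₀).trans hi₀)
        (fun i hi => (hr i).trans (hν i hi))
        (hammingNorm_window_eq hG' hH hGp hG'p hi₀ hν hi₁ hν' hsG hsG' T hT hHwt hHdeg)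
  · rintro ⟨M, hM, hMC⟩
    obtain ⟨G, hGb, hGr, hG, hGd, -⟩ := hC
    have hr := rowDeg_mul_monomial G hM
    have hsG : ∑ i, rowDeg G i = δ := hGr.trans hGd
    have hsH : ∑ i, rowDeg (G * M.map Polynomial.C) i = δ := by rw [hr, hsG]
    have hmap : C.map (Matrix.vecMulLinear (M.map (Polynomial.C : F →+* F[X]))) = C' :=
      SetLike.coe_injective hMC.symm
    refine ⟨⟨(Submodule.equivMapOfInjective _ (vecMul_map_C_injective hM) C).trans
      (LinearEquiv.ofEq _ _ hmap), fun v => wtP_vecMul_monomial hM v,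
      fun v _ => degP_vecMul_monomial hM v⟩,
      G, G * M.map Polynomial.C, hGb, hGr, hG, isBasic_mul hGb (isUnit_det_monomial hM), ?_, ?_,
      hsG, hsH, LinearEquiv.refl F _, fun x y w => (WAMfin_mul_monomial G hM hsG hsH x y w).symm⟩
    · rw [IsRowReduced, degMat_mul_monomial G hM, hr, hGr]
    · rw [hMC, hG, codeOf, codeOf, ← Set.range_comp]
      congr 1
      ext1 u
      exact Matrix.vecMul_vecMul _ _ _
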